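/- Let ℓ be a positive integer and φ : ℕ → [3, ∞) any function. If the series Σ_{n≥1} (log log φ(n))^{ℓ−1} / (φ(n) · log φ(n)) converges, then the Lebesgue measure of E′_ℓ(φ) is 0; if this series diverges, then the Lebesgue measure of E′_ℓ(φ) is 1. -/

import Mathlib

open MeasureTheory Filter Set

/-- The Gauss map `T(x) = 1/x - ⌊1/x⌋` (with `T 0 = 0`). -/
noncomputable def gaussMap (x : ℝ) : ℝ := if x = 0 then 0 else Int.fract x⁻¹

/-- `cfA x n` is the `n`-th partial quotient `a_n(x) = ⌊1 / T^{n-1}(x)⌋` (for `n ≥ 1`). -/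
noncomputable def cfA (x : ℝ) (n : ℕ) : ℕ := ⌊(gaussMap^[n - 1] x)⁻¹⌋₊

/-- `cfA' x n` is `a_n(x)` if it is prime, and `0` otherwise. -/
noncomputable def cfA' (x : ℝ) (n : ℕ) : ℕ := if (cfA x n).Prime then cfA x n else 0

/-- `Eprimeℓ ℓ φ` is the set `E′_ℓ(φ)` of irrational `x ∈ [0,1)` such that
`a′_n(x) ⋯ a′_{n+ℓ-1}(x) ≥ φ(n)` for infinitely many `n ∈ ℕ`. -/
noncomputable def Eprimeℓ (ℓ : ℕ) (φ : ℕ → ℝ) : Set ℝ :=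
  {x | x ∈ Set.Ico (0 : ℝ) 1 ∧ Irrational x ∧
    {n : ℕ | 1 ≤ n ∧ φ n ≤ ∏ i ∈ Finset.range ℓ, (cfA' x (n + i) : ℝ)}.Infinite}

open scoped ENNReal

/-- The sum of `1 / p ^ 2` over the primes `p` with `B ^ j ≤ p < B ^ (j + 1)`. -/
noncomputable def primeBlock (B j : ℕ) : ℝ≥0∞ :=
  ∑' p : ℕ, if p.Prime ∧ Nat.log B p = j then ENNReal.ofReal (1 / (p : ℝ) ^ 2) else 0

/-- The sum of `1 / (p₁ ⋯ p_l) ^ 2` over the tuples of primes with `y ≤ p₁ ⋯ p_l`. -/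
noncomputable def primeTail : ℕ → ℝ → ℝ≥0∞
  | 0, y => if y ≤ 1 then 1 else 0
  | l + 1, y => ∑' p : ℕ,
      if p.Prime then ENNReal.ofReal (1 / (p : ℝ) ^ 2) * primeTail l (y / p) else 0

theorem tsum_primes_eq_tsum_blocks (B : ℕ) (f : ℕ → ℝ≥0∞) :
    (∑' p : ℕ, if p.Prime then f p else 0) =
      ∑' j : ℕ, ∑' p : ℕ, if p.Prime ∧ Nat.log B p = j then f p else 0 := by
  rw [ENNReal.tsum_comm]
  refine tsum_congr fun p => ?_
  by_cases hp : p.Prime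
  · simp [hp]
  · simp [hp]

theorem primeBlock_two_le (j : ℕ) :
    primeBlock 2 j ≤ ENNReal.ofReal (12 / (2 ^ j * (j + 1))) := by
  classical
  set s : Finset ℕ := (Finset.Ioc 0 (2 ^ (j + 1))).filter fun p => p.Prime ∧ Nat.log 2 p = j
  have hs : primeBlock 2 j = ∑ p ∈ s, ENNReal.ofReal (1 / (p : ℝ) ^ 2) := by
    rw [primeBlock, tsum_eq_sum (s := s)]
    · refine Finset.sum_congr rfl fun p hp => ?_
      rw [if_pos (Finset.mem_filter.1 hp).2]
    · intro p hp
      rw [if_neg]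
      rintro ⟨h1, h2⟩
      refine hp (Finset.mem_filter.2 ⟨Finset.mem_Ioc.2 ⟨h1.pos, ?_⟩, h1, h2⟩)
      rw [← h2]
      exact (Nat.lt_pow_succ_log_self (by norm_num) p).le
  rw [hs, ← ENNReal.ofReal_sum_of_nonneg (fun _ _ => by positivity)]
  apply ENNReal.ofReal_le_ofReal
  have hlow : ∀ p ∈ s, (2 : ℝ) ^ j ≤ p := by
    intro p hp
    obtain ⟨-, h1, h2⟩ := Finset.mem_filter.1 hp
    have := Nat.pow_log_le_self 2 h1.ne_zero
    rw [h2] at this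
    exact_mod_cast this
  rcases Nat.eq_zero_or_pos j with rfl | hj
  · have : s = ∅ := by
      refine Finset.filter_eq_empty_iff.2 ?_
      rintro p - ⟨h1, h2⟩
      have := Nat.log_pos (b := 2) (by norm_num) h1.two_le
      omega
    rw [this]
    norm_num
  · have hθ : ∑ p ∈ s, Real.log p ≤ Real.log 4 * 2 ^ (j + 1) := by
      refine le_trans ?_ (Chebyshev.theta_le_log4_mul_x (x := 2 ^ (j + 1)) (by positivity))
      rw [Chebyshev.theta]
      refine Finset.sum_le_sum_of_subset_of_nonneg ?_ fun p _ _ => Real.log_natCast_nonneg p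
      intro p hp
      obtain ⟨h0, h1, h2⟩ := Finset.mem_filter.1 hp
      have : ⌊(2 : ℝ) ^ (j + 1)⌋₊ = 2 ^ (j + 1) := by
        exact_mod_cast Nat.floor_natCast (R := ℝ) (2 ^ (j + 1))
      rw [this]
      exact Finset.mem_filter.2 ⟨h0, h1⟩
    have hterm : ∀ p ∈ s, 1 / (p : ℝ) ^ 2 ≤ Real.log p / (j * Real.log 2 * (2 ^ j) ^ 2) := by
      intro p hp
      have h1 := hlow p hp
      have h2 : j * Real.log 2 ≤ Real.log p := by
        rw [← Real.log_pow]
        exact Real.log_le_log (by positivity) h1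
      have hl : 0 < j * Real.log 2 := by positivity
      calc 1 / (p : ℝ) ^ 2 ≤ 1 / (2 ^ j) ^ 2 := by gcongr
        _ = (j * Real.log 2) / (j * Real.log 2 * (2 ^ j) ^ 2) := by field_simp
        _ ≤ _ := by gcongr
    calc ∑ p ∈ s, 1 / (p : ℝ) ^ 2 ≤ ∑ p ∈ s, Real.log p / (j * Real.log 2 * (2 ^ j) ^ 2) :=
          Finset.sum_le_sum hterm
      _ = (∑ p ∈ s, Real.log p) / (j * Real.log 2 * (2 ^ j) ^ 2) := by rw [Finset.sum_div]
      _ ≤ (Real.log 4 * 2 ^ (j + 1)) / (j * Real.log 2 * (2 ^ j) ^ 2) := by gcongr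
      _ = 4 / (2 ^ j * j) := by
          rw [show (4 : ℝ) = 2 ^ 2 by norm_num, Real.log_pow]
          field_simp
          push_cast
          ring
      _ ≤ 12 / (2 ^ j * (j + 1)) := by
          have : (1 : ℝ) ≤ j := by exact_mod_cast hj
          rw [div_le_div_iff₀ (by positivity) (by positivity)]
          have : (0 : ℝ) < 2 ^ j := by positivity
          nlinarith

theorem eventually_half_le_theta : ∀ᶠ n : ℕ in atTop, (n : ℝ) / 2 ≤ Chebyshev.theta n := by
  have h1 : Tendsto (fun x : ℝ => (Real.log (x + 1)) / x) atTop (nhds 0) := by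
    have := (Real.isLittleO_log_id_atTop.comp_tendsto
      (tendsto_atTop_add_const_right atTop (1 : ℝ) tendsto_id))
    have h2 : (fun x : ℝ => x + 1) =O[atTop] fun x : ℝ => x := by
      refine Asymptotics.IsBigO.of_bound 2 ?_
      filter_upwards [eventually_ge_atTop 1] with x hx
      rw [Real.norm_of_nonneg (by linarith), Real.norm_of_nonneg (by linarith)]
      linarith
    exact (this.trans_isBigO h2).tendsto_div_nhds_zero
  have h2 : Tendsto (fun x : ℝ => 2 * √x * Real.log x / x) atTop (nhds 0) := by
    have := (isLittleO_log_rpow_atTop (r := 1 / 2) (by norm_num)).tendsto_div_nhds_zero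
    have h3 := this.const_mul 2
    rw [mul_zero] at h3
    refine h3.congr' ?_
    filter_upwards [eventually_gt_atTop 0] with x hx
    rw [← Real.sqrt_eq_rpow]
    have : √x * √x = x := Real.mul_self_sqrt hx.le
    have h4 : 0 < √x := Real.sqrt_pos.2 hx
    field_simp
    linear_combination (-Real.log x) * this
  have h3 := (h1.add h2).comp tendsto_natCast_atTop_atTop (α := ℕ)
  rw [add_zero] at h3
  have hl : (0.69 : ℝ) < Real.log 2 := by linarith [Real.log_two_gt_d9]
  filter_upwards [h3.eventually (gt_mem_nhds (show (0 : ℝ) < 0.19 by norm_num)),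
    eventually_gt_atTop 0] with n hn hpos
  have hn0 : (0 : ℝ) < n := by exact_mod_cast hpos
  refine le_trans ?_ (Chebyshev.theta_ge n)
  simp only [Function.comp_apply] at hn
  rw [← add_div, div_lt_iff₀ hn0] at hn
  nlinarith

theorem le_primeBlock_four :
    ∃ k : ℝ, 0 < k ∧ ∀ j : ℕ, ENNReal.ofReal (k / (4 ^ j * (j + 1))) ≤ primeBlock 4 j := by
  obtain ⟨N, hN⟩ := eventually_atTop.1 eventually_half_le_theta
  refine ⟨min (1 / 64) (1 / 16 ^ (N + 1)), by positivity, fun j => ?_⟩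
  set s : Finset ℕ := (Finset.Ioc (4 ^ j) (4 ^ (j + 1))).filter Nat.Prime with hs
  have hmem : ∀ p ∈ s, p.Prime ∧ Nat.log 4 p = j := by
    intro p hp
    obtain ⟨h0, h1⟩ := Finset.mem_filter.1 hp
    obtain ⟨h2, h3⟩ := Finset.mem_Ioc.1 h0
    refine ⟨h1, (Nat.log_eq_iff (Or.inr ⟨by norm_num, h1.ne_zero⟩)).2 ⟨h2.le, ?_⟩⟩
    refine lt_of_le_of_ne h3 ?_
    rintro rfl
    refine Nat.Prime.not_prime_pow (x := 2) (n := 2 * (j + 1)) (by omega) ?_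
    rwa [pow_mul]
  have hup : ∀ p ∈ s, (p : ℝ) ≤ 4 ^ (j + 1) := fun p hp => by
    exact_mod_cast (Finset.mem_Ioc.1 (Finset.mem_filter.1 hp).1).2
  have hsum : ENNReal.ofReal (∑ p ∈ s, 1 / (p : ℝ) ^ 2) ≤ primeBlock 4 j := by
    rw [ENNReal.ofReal_sum_of_nonneg (fun _ _ => by positivity), primeBlock]
    refine le_trans (le_of_eq ?_) (ENNReal.sum_le_tsum s)
    refine Finset.sum_congr rfl fun p hp => ?_
    rw [if_pos (hmem p hp)]
  refine le_trans (ENNReal.ofReal_le_ofReal ?_) hsum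
  have hpos : (0 : ℝ) < 4 ^ j := by positivity
  by_cases hj : N ≤ j
  · have hθ : (4 : ℝ) ^ j / 2 ≤ ∑ p ∈ s, Real.log p := by
      have h1 : Chebyshev.theta ((4 ^ (j + 1) : ℕ) : ℝ) =
          Chebyshev.theta ((4 ^ j : ℕ) : ℝ) + ∑ p ∈ s, Real.log p := by
        rw [Chebyshev.theta, Chebyshev.theta, Nat.floor_natCast, Nat.floor_natCast, hs,
          ← Finset.sum_union]
        · rw [← Finset.filter_union, Finset.Ioc_union_Ioc_eq_Ioc (Nat.zero_le _)
            (Nat.pow_le_pow_right (by norm_num) (Nat.le_succ _))]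
        · exact Finset.disjoint_filter_filter (Finset.Ioc_disjoint_Ioc_of_le le_rfl)
      have h2 := hN (4 ^ (j + 1)) (by
        have : j + 1 < 4 ^ (j + 1) := Nat.lt_pow_self (by norm_num)
        omega)
      have h3 := Chebyshev.theta_le_log4_mul_x (x := ((4 ^ j : ℕ) : ℝ)) (by positivity)
      have h4 : Real.log 4 < 1.4 := by
        rw [show (4 : ℝ) = 2 ^ 2 by norm_num, Real.log_pow]
        push_cast
        linarith [Real.log_two_lt_d9]
      rw [h1] at h2
      push_cast [pow_succ] at h2 h3 ⊢
      nlinarith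
    have hterm : ∀ p ∈ s, Real.log p / ((j + 1) * 2 * (4 ^ (j + 1)) ^ 2) ≤ 1 / (p : ℝ) ^ 2 := by
      intro p hp
      have hp0 : (0 : ℝ) < p := by exact_mod_cast (hmem p hp).1.pos
      have h2 : Real.log p ≤ (j + 1) * 2 := by
        have h3 := Real.log_le_log hp0 (hup p hp)
        rw [Real.log_pow] at h3
        have h4 : Real.log 4 < 2 := by
          rw [show (4 : ℝ) = 2 ^ 2 by norm_num, Real.log_pow]
          push_cast
          linarith [Real.log_two_lt_d9]
        push_cast at h3
        have : (0 : ℝ) ≤ j := by positivity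
        nlinarith
      calc Real.log p / ((j + 1) * 2 * (4 ^ (j + 1)) ^ 2)
          ≤ ((j + 1) * 2) / ((j + 1) * 2 * (4 ^ (j + 1)) ^ 2) := by gcongr
        _ = 1 / (4 ^ (j + 1)) ^ 2 := by field_simp
        _ ≤ 1 / (p : ℝ) ^ 2 := by gcongr; exact hup p hp
    calc min (1 / 64 : ℝ) (1 / 16 ^ (N + 1)) / (4 ^ j * (j + 1))
        ≤ (1 / 64) / (4 ^ j * (j + 1)) := by gcongr; exact min_le_left _ _
      _ = (4 ^ j / 2) / ((j + 1) * 2 * (4 ^ (j + 1)) ^ 2) := by field_simp; ring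
      _ ≤ (∑ p ∈ s, Real.log p) / ((j + 1) * 2 * (4 ^ (j + 1)) ^ 2) := by gcongr
      _ = ∑ p ∈ s, Real.log p / ((j + 1) * 2 * (4 ^ (j + 1)) ^ 2) := by rw [Finset.sum_div]
      _ ≤ _ := Finset.sum_le_sum hterm
  · obtain ⟨p, hp, hp1, hp2⟩ := Nat.exists_prime_lt_and_le_two_mul (4 ^ j) (by positivity)
    have hps : p ∈ s := Finset.mem_filter.2 ⟨Finset.mem_Ioc.2 ⟨hp1, by rw [pow_succ]; omega⟩, hp⟩
    have hp0 : (0 : ℝ) < p := by exact_mod_cast hp.pos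
    calc min (1 / 64 : ℝ) (1 / 16 ^ (N + 1)) / (4 ^ j * (j + 1))
        ≤ (1 / 16 ^ (N + 1)) / 1 := by
          gcongr
          · exact min_le_right _ _
          · exact one_le_mul_of_one_le_of_one_le (one_le_pow₀ (by norm_num)) (by simp)
      _ ≤ 1 / 16 ^ (j + 1) := by
          rw [div_one]
          gcongr
          · norm_num
          · omega
      _ = 1 / (4 ^ (j + 1)) ^ 2 := by rw [← pow_mul, mul_comm, pow_mul]; norm_num
      _ ≤ 1 / (p : ℝ) ^ 2 := by gcongr; exact hup p hps
      _ ≤ _ := Finset.single_le_sum (f := fun p : ℕ => 1 / (p : ℝ) ^ 2)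
          (fun _ _ => by positivity) hps

theorem primeTail_succ (B l : ℕ) (y : ℝ) :
    primeTail (l + 1) y = ∑' j : ℕ, ∑' p : ℕ, if p.Prime ∧ Nat.log B p = j then
      ENNReal.ofReal (1 / (p : ℝ) ^ 2) * primeTail l (y / p) else 0 := by
  rw [primeTail, tsum_primes_eq_tsum_blocks B]

theorem tsum_block_le (B l j : ℕ) (y : ℝ) (D : ℝ≥0∞)
    (h : ∀ p : ℕ, p.Prime → Nat.log B p = j → primeTail l (y / p) ≤ D) :
    (∑' p : ℕ, if p.Prime ∧ Nat.log B p = j then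
      ENNReal.ofReal (1 / (p : ℝ) ^ 2) * primeTail l (y / p) else 0) ≤ primeBlock B j * D := by
  rw [primeBlock, ← ENNReal.tsum_mul_right]
  refine ENNReal.tsum_le_tsum fun p => ?_
  split_ifs with hp
  · gcongr
    exact h p hp.1 hp.2
  · simp

theorem le_tsum_block (B l j : ℕ) (y : ℝ) (D : ℝ≥0∞)
    (h : ∀ p : ℕ, p.Prime → Nat.log B p = j → D ≤ primeTail l (y / p)) :
    primeBlock B j * D ≤ ∑' p : ℕ, if p.Prime ∧ Nat.log B p = j then
      ENNReal.ofReal (1 / (p : ℝ) ^ 2) * primeTail l (y / p) else 0 := by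
  rw [primeBlock, ← ENNReal.tsum_mul_right]
  refine ENNReal.tsum_le_tsum fun p => ?_
  split_ifs with hp
  · gcongr
    exact h p hp.1 hp.2
  · simp

theorem tsum_primeBlock_two_le (m : ℕ) :
    ∑' j : ℕ, primeBlock 2 (j + m) ≤ ENNReal.ofReal (24 / (2 ^ m * (m + 1))) := by
  have hg : HasSum (fun j : ℕ => 12 / (2 ^ m * (m + 1)) * (1 / 2 : ℝ) ^ j)
      (12 / (2 ^ m * (m + 1)) * 2) := hasSum_geometric_two.mul_left _
  calc ∑' j : ℕ, primeBlock 2 (j + m)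
      ≤ ∑' j : ℕ, ENNReal.ofReal (12 / (2 ^ m * (m + 1)) * (1 / 2 : ℝ) ^ j) := by
        refine ENNReal.tsum_le_tsum fun j => (primeBlock_two_le _).trans ?_
        apply ENNReal.ofReal_le_ofReal
        rw [div_mul_eq_mul_div, one_div, inv_pow, ← div_eq_mul_inv, div_div]
        have h : (m : ℝ) ≤ ((j + m : ℕ) : ℝ) := by exact_mod_cast Nat.le_add_left _ _
        calc (12 : ℝ) / (2 ^ (j + m) * (((j + m : ℕ) : ℝ) + 1))
            ≤ 12 / (2 ^ (j + m) * (m + 1)) := by gcongr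
          _ = _ := by rw [pow_add]; ring
    _ = ENNReal.ofReal (12 / (2 ^ m * (m + 1)) * 2) := by
        rw [← ENNReal.ofReal_tsum_of_nonneg (fun _ => by positivity) hg.summable, hg.tsum_eq]
    _ = _ := by ring_nf

theorem primeTail_le_pow (l : ℕ) (y : ℝ) : primeTail l y ≤ ENNReal.ofReal (24 ^ l) := by
  induction l generalizing y with
  | zero => simp only [primeTail]; split_ifs <;> simp
  | succ l ih =>
    rw [primeTail_succ 2]
    calc _ ≤ ∑' j : ℕ, primeBlock 2 (j + 0) * ENNReal.ofReal (24 ^ l) :=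
          ENNReal.tsum_le_tsum fun j => tsum_block_le _ _ _ _ _ fun p _ _ => ih _
      _ = (∑' j : ℕ, primeBlock 2 (j + 0)) * ENNReal.ofReal (24 ^ l) := ENNReal.tsum_mul_right
      _ ≤ ENNReal.ofReal (24 / (2 ^ 0 * ((0 : ℕ) + 1))) * ENNReal.ofReal (24 ^ l) := by
          gcongr
          exact tsum_primeBlock_two_le 0
      _ = _ := by
          rw [← ENNReal.ofReal_mul (by positivity)]
          norm_num [pow_succ, mul_comm]

theorem log_le_sum_inv (m : ℕ) :
    Real.log (m + 1) ≤ ∑ j ∈ Finset.range m, 1 / ((j : ℝ) + 1) := by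
  have := log_add_one_le_harmonic m
  simpa [harmonic] using this

theorem sum_inv_le_log (m : ℕ) :
    ∑ j ∈ Finset.range m, 1 / ((j : ℝ) + 1) ≤ 3 * Real.log (m + 2) := by
  have h1 := harmonic_le_one_add_log m
  have h2 : Real.log 2 ≤ Real.log (m + 2) := Real.log_le_log (by norm_num) (by simp)
  have h3 : Real.log m ≤ Real.log (m + 2) := by
    rcases Nat.eq_zero_or_pos m with rfl | hm
    · simp; positivity
    · exact Real.log_le_log (by exact_mod_cast hm) (by simp)
  have h4 : ∑ j ∈ Finset.range m, 1 / ((j : ℝ) + 1) ≤ 1 + Real.log m := by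
    simpa [harmonic] using h1
  linarith [Real.log_two_gt_d9]

theorem sum_inv_mul_inv_le (m : ℕ) :
    ∑ j ∈ Finset.range m, 1 / (((j : ℝ) + 1) * ((m - 1 - j : ℕ) + 1)) ≤
      6 * Real.log (m + 2) / (m + 1) := by
  have h1 : ∑ j ∈ Finset.range m, 1 / (((m - 1 - j : ℕ) : ℝ) + 1) =
      ∑ j ∈ Finset.range m, 1 / ((j : ℝ) + 1) :=
    Finset.sum_range_reflect (fun j : ℕ => 1 / ((j : ℝ) + 1)) m
  have h2 : ∑ j ∈ Finset.range m, 1 / (((j : ℝ) + 1) * ((m - 1 - j : ℕ) + 1)) =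
      (∑ j ∈ Finset.range m, (1 / ((j : ℝ) + 1) + 1 / (((m - 1 - j : ℕ) : ℝ) + 1))) / (m + 1) := by
    rw [Finset.sum_div]
    refine Finset.sum_congr rfl fun j hj => ?_
    have hj' : j + (m - 1 - j) + 1 = m := by have := Finset.mem_range.1 hj; omega
    have h3 : (m : ℝ) = j + (m - 1 - j : ℕ) + 1 := by exact_mod_cast hj'.symm
    rw [h3]
    field_simp
    ring
  rw [h2, Finset.sum_add_distrib, h1]
  gcongr
  linarith [sum_inv_le_log m]

theorem tsum_eq_sum_range_add_tsum (f : ℕ → ℝ≥0∞) (m : ℕ) :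
    ∑' j, f j = ∑ j ∈ Finset.range m, f j + ∑' j, f (j + m) :=
  (ENNReal.summable.sum_add_tsum_nat_add').symm

theorem exists_primeTail_le (l : ℕ) : ∃ C : ℝ, 0 < C ∧ ∀ (m : ℕ) (y : ℝ), 2 ^ m ≤ y →
    primeTail (l + 1) y ≤ ENNReal.ofReal (C * Real.log (m + 2) ^ l / ((m + 1) * 2 ^ m)) := by
  induction l with
  | zero =>
    refine ⟨24, by norm_num, fun m y hy => ?_⟩
    rw [primeTail_succ 2]
    have hzero : ∀ j < m, (∑' p : ℕ, if p.Prime ∧ Nat.log 2 p = j then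
        ENNReal.ofReal (1 / (p : ℝ) ^ 2) * primeTail 0 (y / p) else 0) = 0 := by
      intro j hj
      refine ENNReal.tsum_eq_zero.2 fun p => ?_
      split_ifs with hp
      · have h1 : p < 2 ^ m := by
          have := Nat.lt_pow_succ_log_self (b := 2) (by norm_num) p
          rw [hp.2] at this
          exact this.trans_le (Nat.pow_le_pow_right (by norm_num) hj)
        have h2 : (p : ℝ) < y := lt_of_lt_of_le (by exact_mod_cast h1) hy
        have h3 : (0 : ℝ) < p := by exact_mod_cast hp.1.pos
        rw [primeTail, if_neg, mul_zero]
        rw [not_le, one_lt_div h3]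
        exact h2
      · rfl
    have htail : (∑' j : ℕ, ∑' p : ℕ, if p.Prime ∧ Nat.log 2 p = j + m then
        ENNReal.ofReal (1 / (p : ℝ) ^ 2) * primeTail 0 (y / p) else 0) ≤
        ∑' j : ℕ, primeBlock 2 (j + m) := by
      refine ENNReal.tsum_le_tsum fun j => ?_
      refine (tsum_block_le 2 0 (j + m) y 1 fun p _ _ => ?_).trans (mul_one _).le
      simpa only [pow_zero, ENNReal.ofReal_one] using primeTail_le_pow 0 (y / p)
    rw [tsum_eq_sum_range_add_tsum _ m,
      Finset.sum_eq_zero fun j hj => hzero j (Finset.mem_range.1 hj), zero_add]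
    refine htail.trans ((tsum_primeBlock_two_le m).trans (le_of_eq ?_))
    rw [pow_zero, mul_one, mul_comm ((2 : ℝ) ^ m)]
  | succ l ih =>
    obtain ⟨C, hC, ih⟩ := ih
    refine ⟨144 * C + 24 ^ (l + 2) * 2 ^ (l + 1), by positivity, fun m y hy => ?_⟩
    obtain ⟨L, hL⟩ : ∃ L, L = Real.log ((m : ℝ) + 2) := ⟨_, rfl⟩
    rw [← hL]
    have hL2 : 1 / 2 ≤ L := by
      have : Real.log 2 ≤ L := hL ▸ Real.log_le_log (by norm_num) (by simp)
      linarith [Real.log_two_gt_d9]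
    have hL0 : 0 < L := by linarith
    rw [primeTail_succ 2, tsum_eq_sum_range_add_tsum _ m]
    have hfirst : ∀ j ∈ Finset.range m, (∑' p : ℕ, if p.Prime ∧ Nat.log 2 p = j then
        ENNReal.ofReal (1 / (p : ℝ) ^ 2) * primeTail (l + 1) (y / p) else 0) ≤
        ENNReal.ofReal (24 * C * L ^ l / 2 ^ m * (1 / (((j : ℝ) + 1) * ((m - 1 - j : ℕ) + 1)))) := by
      intro j hj
      have hj := Finset.mem_range.1 hj
      obtain ⟨i, hi⟩ : ∃ i, i = m - 1 - j := ⟨_, rfl⟩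
      rw [← hi]
      have him : j + 1 + i = m := by omega
      refine (tsum_block_le _ _ _ _ (ENNReal.ofReal (C * L ^ l / ((i + 1) * 2 ^ i)))
        fun p hp hpj => ?_).trans ?_
      · refine (ih i _ ?_).trans (ENNReal.ofReal_le_ofReal ?_)
        · have h1 := (Nat.lt_pow_succ_log_self (b := 2) (by norm_num) p).le
          rw [hpj] at h1
          have h2 : (p : ℝ) ≤ 2 ^ (j + 1) := by exact_mod_cast h1
          rw [le_div_iff₀ (by exact_mod_cast hp.pos)]
          calc (2 : ℝ) ^ i * p ≤ 2 ^ i * 2 ^ (j + 1) := by gcongr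
            _ = 2 ^ m := by rw [← pow_add, ← him, add_comm]
            _ ≤ y := hy
        · have : (i : ℝ) ≤ m := by exact_mod_cast (by omega : i ≤ m)
          have hiL : Real.log (i + 2) ≤ L := hL ▸ Real.log_le_log (by positivity) (by linarith)
          have hi0 : 0 ≤ Real.log ((i : ℝ) + 2) :=
            Real.log_nonneg (by linarith [Nat.cast_nonneg (α := ℝ) i])
          gcongr
      · grw [primeBlock_two_le]
        rw [← ENNReal.ofReal_mul (by positivity)]
        apply le_of_eq
        congr 1
        rw [← him, pow_add, pow_succ]
        field_simp
        norm_num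
    have hsnd : (∑' j : ℕ, ∑' p : ℕ, if p.Prime ∧ Nat.log 2 p = j + m then
        ENNReal.ofReal (1 / (p : ℝ) ^ 2) * primeTail (l + 1) (y / p) else 0) ≤
        ENNReal.ofReal (24 ^ (l + 2) / (2 ^ m * (m + 1))) := by
      calc _ ≤ ∑' j : ℕ, primeBlock 2 (j + m) * ENNReal.ofReal (24 ^ (l + 1)) :=
            ENNReal.tsum_le_tsum fun j => tsum_block_le _ _ _ _ _ fun p _ _ =>
              primeTail_le_pow _ _
        _ = (∑' j : ℕ, primeBlock 2 (j + m)) * ENNReal.ofReal (24 ^ (l + 1)) :=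
            ENNReal.tsum_mul_right
        _ ≤ ENNReal.ofReal (24 / (2 ^ m * (m + 1))) * ENNReal.ofReal (24 ^ (l + 1)) := by
            gcongr
            exact tsum_primeBlock_two_le m
        _ = _ := by
            rw [← ENNReal.ofReal_mul (by positivity)]
            congr 1
            ring
    refine (add_le_add (Finset.sum_le_sum hfirst) hsnd).trans ?_
    rw [← ENNReal.ofReal_sum_of_nonneg (fun _ _ => by positivity), ← Finset.mul_sum,
      ← ENNReal.ofReal_add
        (mul_nonneg (by positivity) (Finset.sum_nonneg fun _ _ => by positivity)) (by positivity)]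
    apply ENNReal.ofReal_le_ofReal
    have h1 : (1 : ℝ) ≤ 2 ^ (l + 1) * L ^ (l + 1) := by
      rw [← mul_pow]
      exact one_le_pow₀ (by linarith)
    calc _ ≤ 24 * C * L ^ l / 2 ^ m * (6 * L / (m + 1)) +
          24 ^ (l + 2) / (2 ^ m * (m + 1)) * (2 ^ (l + 1) * L ^ (l + 1)) := by
          refine add_le_add (mul_le_mul_of_nonneg_left (hL ▸ sum_inv_mul_inv_le m)
            (by positivity)) ?_
          exact le_mul_of_one_le_right (by positivity) h1
      _ = _ := by field_simp; ring

theorem exists_le_primeTail (l : ℕ) : ∃ c : ℝ, 0 < c ∧ ∀ (m : ℕ) (y : ℝ), y ≤ 4 ^ m →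
    ENNReal.ofReal (c * Real.log (m + 2) ^ l / ((m + 1) * 4 ^ m)) ≤ primeTail (l + 1) y := by
  obtain ⟨k, hk, hblock⟩ := le_primeBlock_four
  have hp4 : ∀ (p j : ℕ), p.Prime → Nat.log 4 p = j → (4 : ℝ) ^ j ≤ p := by
    intro p j hp hj
    have := Nat.pow_log_le_self 4 hp.ne_zero
    rw [hj] at this
    exact_mod_cast this
  induction l with
  | zero =>
    refine ⟨k, hk, fun m y hy => ?_⟩
    rw [primeTail_succ 4]
    calc _ = ENNReal.ofReal (k / (4 ^ m * (m + 1))) := by simp [mul_comm]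
      _ ≤ primeBlock 4 m * 1 := by simpa using hblock m
      _ ≤ _ := le_tsum_block 4 0 m y 1 fun p hp hpm => by
          have h3 : (0 : ℝ) < p := by exact_mod_cast hp.pos
          rw [primeTail, if_pos]
          rw [div_le_one h3]
          exact hy.trans (hp4 p m hp hpm)
      _ ≤ _ := ENNReal.le_tsum m
  | succ l ih =>
    obtain ⟨c, hc, ih⟩ := ih
    refine ⟨k * c / 2 ^ (l + 1), by positivity, fun m y hy => ?_⟩
    set L := Real.log (m + 2) with hL
    have hL0 : 0 < L := Real.log_pos (by have : (0 : ℝ) ≤ m := by positivity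
                                         linarith)
    have hhalf : L / 2 ≤ Real.log ((m / 2 : ℕ) + 2) := by
      have h1 : (m : ℝ) ≤ 2 * (m / 2 : ℕ) + 1 := by exact_mod_cast (by omega : m ≤ 2 * (m / 2) + 1)
      have h2 : L ≤ Real.log ((((m / 2 : ℕ) : ℝ) + 2) ^ 2) :=
        Real.log_le_log (by positivity) (by nlinarith)
      rw [Real.log_pow] at h2
      push_cast at h2 ⊢
      linarith
    rw [primeTail_succ 4]
    refine le_trans ?_ (ENNReal.sum_le_tsum (Finset.range (m / 2 + 1)))
    have hterm : ∀ j ∈ Finset.range (m / 2 + 1),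
        ENNReal.ofReal (k * c * (L / 2) ^ l / ((m + 1) * 4 ^ m) * (1 / ((j : ℝ) + 1))) ≤
        ∑' p : ℕ, if p.Prime ∧ Nat.log 4 p = j then
        ENNReal.ofReal (1 / (p : ℝ) ^ 2) * primeTail (l + 1) (y / p) else 0 := by
      intro j hj
      have hj := Finset.mem_range.1 hj
      obtain ⟨i, hi⟩ : ∃ i, i + j = m := ⟨m - j, by omega⟩
      refine le_trans ?_ (le_tsum_block 4 (l + 1) j y
        (ENNReal.ofReal (c * Real.log (i + 2) ^ l / ((i + 1) * 4 ^ i))) fun p hp hpj => ?_)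
      · grw [← hblock j]
        rw [← ENNReal.ofReal_mul (by positivity)]
        apply ENNReal.ofReal_le_ofReal
        have him : (i : ℝ) ≤ m := by exact_mod_cast (by omega : i ≤ m)
        have hli : L / 2 ≤ Real.log (i + 2) := by
          refine hhalf.trans (Real.log_le_log (by positivity) ?_)
          exact_mod_cast (by omega : m / 2 + 2 ≤ i + 2)
        have hli0 : 0 ≤ Real.log ((i : ℝ) + 2) := le_trans (by positivity) hli
        calc k * c * (L / 2) ^ l / ((m + 1) * 4 ^ m) * (1 / ((j : ℝ) + 1))
            ≤ k * c * Real.log (i + 2) ^ l / ((i + 1) * 4 ^ m) * (1 / ((j : ℝ) + 1)) := by gcongr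
          _ = _ := by
            rw [← hi, pow_add]
            field_simp
      · refine ih i _ ?_
        rw [div_le_iff₀ (by exact_mod_cast hp.pos)]
        calc y ≤ 4 ^ m := hy
          _ = 4 ^ i * 4 ^ j := by rw [← hi, pow_add]
          _ ≤ 4 ^ i * p := by gcongr; exact hp4 p j hp hpj
    refine le_trans ?_ (Finset.sum_le_sum hterm)
    rw [← ENNReal.ofReal_sum_of_nonneg (fun _ _ => by positivity), ← Finset.mul_sum]
    apply ENNReal.ofReal_le_ofReal
    have h1 := log_le_sum_inv (m / 2 + 1)
    push_cast at h1
    calc _ = k * c * (L / 2) ^ l / ((m + 1) * 4 ^ m) * (L / 2) := by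
          rw [div_pow, pow_succ, pow_succ]
          field_simp
      _ ≤ _ := by
          gcongr
          refine hhalf.trans (le_trans (le_of_eq ?_) h1)
          ring_nf

theorem log_three_gt_one : 1 < Real.log 3 :=
  (Real.lt_log_iff_exp_lt (by norm_num)).2 (Real.exp_one_lt_d9.trans (by norm_num))

theorem exists_primeTail_le_of_three_le (l : ℕ) : ∃ C : ℝ, 0 < C ∧ ∀ y : ℝ, 3 ≤ y →
    primeTail (l + 1) y ≤
      ENNReal.ofReal (C * (Real.log (Real.log y) ^ l / (y * Real.log y))) := by
  obtain ⟨C, hC, h⟩ := exists_primeTail_le l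
  have h3 := log_three_gt_one
  set K : ℝ := 1 + Real.log 4 / Real.log (Real.log 3)
  have hl3 : 0 < Real.log (Real.log 3) := Real.log_pos h3
  have hl4 : 0 < Real.log 4 := Real.log_pos (by norm_num)
  refine ⟨2 * C * K ^ l, by positivity, fun y hy => ?_⟩
  obtain ⟨m, hm1, hm2⟩ := exists_nat_pow_near (by linarith : 1 ≤ y) (by norm_num : (1 : ℝ) < 2)
  refine (h m y hm1).trans (ENNReal.ofReal_le_ofReal ?_)
  have hy0 : 0 < y := by linarith
  have hly : Real.log 3 ≤ Real.log y := Real.log_le_log (by norm_num) hy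
  have hly0 : 0 < Real.log y := by linarith
  have hm0 : (0 : ℝ) ≤ m := by positivity
  have hlog1 : m * Real.log 2 ≤ Real.log y := by
    rw [← Real.log_pow]; exact Real.log_le_log (by positivity) hm1
  have hlog2 : Real.log y ≤ m + 1 := by
    have := Real.log_le_log hy0 hm2.le
    rw [Real.log_pow] at this
    push_cast at this
    nlinarith [Real.log_two_lt_d9]
  have hLL : Real.log (m + 2) ≤ K * Real.log (Real.log y) := by
    have h1 : Real.log (m + 2) ≤ Real.log (4 * Real.log y) :=
      Real.log_le_log (by positivity) (by nlinarith [Real.log_two_gt_d9])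
    rw [Real.log_mul (by norm_num) hly0.ne'] at h1
    have h2 : Real.log (Real.log 3) ≤ Real.log (Real.log y) := Real.log_le_log (by linarith) hly
    have h4 : Real.log 4 ≤ Real.log 4 / Real.log (Real.log 3) * Real.log (Real.log y) := by
      rw [div_mul_eq_mul_div, le_div_iff₀ hl3]
      gcongr
    simp only [K]
    linarith
  have hLL0 : 0 ≤ Real.log (m + 2) := Real.log_nonneg (by linarith)
  calc C * Real.log (m + 2) ^ l / ((m + 1) * 2 ^ m)
      ≤ C * (K * Real.log (Real.log y)) ^ l / (Real.log y * (y / 2)) := by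
        rw [pow_succ] at hm2
        gcongr
        · have : 0 ≤ K * Real.log (Real.log y) := hLL0.trans hLL
          positivity
        · linarith
    _ = _ := by rw [mul_pow]; field_simp

theorem exists_le_primeTail_of_three_le (l : ℕ) : ∃ c : ℝ, 0 < c ∧ ∀ y : ℝ, 3 ≤ y →
    ENNReal.ofReal (c * (Real.log (Real.log y) ^ l / (y * Real.log y))) ≤
      primeTail (l + 1) y := by
  obtain ⟨c, hc, h⟩ := exists_le_primeTail l
  have h3 := log_three_gt_one
  refine ⟨c / (12 * 2 ^ l), by positivity, fun y hy => ?_⟩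
  obtain ⟨m, hm1, hm2⟩ := exists_nat_pow_near (by linarith : 1 ≤ y) (by norm_num : (1 : ℝ) < 4)
  refine le_trans (ENNReal.ofReal_le_ofReal ?_) (h (m + 1) y hm2.le)
  have hy0 : 0 < y := by linarith
  have hly : Real.log 3 ≤ Real.log y := Real.log_le_log (by norm_num) hy
  have hly0 : 0 < Real.log y := by linarith
  have hm0 : (0 : ℝ) ≤ m := by positivity
  have hlog4 : Real.log 4 = 2 * Real.log 2 := by
    rw [show (4 : ℝ) = 2 ^ 2 by norm_num, Real.log_pow]; push_cast; ring
  have hlog1 : m * Real.log 4 ≤ Real.log y := by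
    rw [← Real.log_pow]; exact Real.log_le_log (by positivity) hm1
  have hlog2 : Real.log y ≤ 2 * (m + 1) := by
    have := Real.log_le_log hy0 hm2.le
    rw [Real.log_pow] at this
    push_cast at this
    nlinarith [Real.log_two_lt_d9]
  have hLL : Real.log (Real.log y) / 2 ≤ Real.log (m + 3) := by
    have h1 : Real.log (Real.log y) ≤ Real.log (((m : ℝ) + 3) ^ 2) :=
      Real.log_le_log hly0 (by nlinarith)
    rw [Real.log_pow] at h1
    push_cast at h1
    linarith
  have hLL0 : 0 ≤ Real.log (Real.log y) := Real.log_nonneg (by linarith)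
  have hm3 : (m : ℝ) + 2 ≤ 3 * Real.log y := by nlinarith [Real.log_two_gt_d9]
  have hmy : (4 : ℝ) ^ (m + 1) ≤ 4 * y := by rw [pow_succ]; linarith
  have hLm : 0 ≤ Real.log ((m : ℝ) + 3) := le_trans (by positivity) hLL
  calc c / (12 * 2 ^ l) * (Real.log (Real.log y) ^ l / (y * Real.log y))
      = c * (Real.log (Real.log y) / 2) ^ l / ((3 * Real.log y) * (4 * y)) := by
        rw [div_pow]; field_simp; ring
    _ ≤ c * Real.log (m + 3) ^ l / ((m + 2) * 4 ^ (m + 1)) := by gcongr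
    _ = _ := by push_cast; ring_nf

theorem measurable_gaussMap : Measurable gaussMap := by
  unfold gaussMap
  exact Measurable.ite (measurableSet_singleton 0) measurable_const
    (measurable_fract.comp measurable_inv)

theorem measurable_cfA' (n : ℕ) : Measurable fun x => cfA' x n := by
  have h : Measurable fun x => cfA x n :=
    Nat.measurable_floor.comp (measurable_inv.comp (measurable_gaussMap.iterate (n - 1)))
  exact (measurable_from_top (f := fun m : ℕ => if m.Prime then m else 0)).comp h

/-- The product `a'_1(x) ⋯ a'_l(x)`. -/
noncomputable def blockProd (l : ℕ) (x : ℝ) : ℕ := ∏ i ∈ Finset.range l, cfA' x (i + 1)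

theorem measurable_blockProd (l : ℕ) : Measurable (blockProd l) :=
  Finset.measurable_fun_prod _ fun i _ => measurable_cfA' (i + 1)

theorem cfA'_add (x : ℝ) (n i : ℕ) : cfA' x (n + i + 1) = cfA' (gaussMap^[n] x) (i + 1) := by
  have : cfA x (n + i + 1) = cfA (gaussMap^[n] x) (i + 1) := by
    simp only [cfA, Nat.add_sub_cancel]
    rw [add_comm n i, Function.iterate_add_apply]
  simp only [cfA', this]

theorem blockProd_succ (l : ℕ) (x : ℝ) :
    blockProd (l + 1) x = cfA' x 1 * blockProd l (gaussMap x) := by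
  rw [blockProd, Finset.prod_range_succ', mul_comm, blockProd]
  congr 1

theorem prod_cfA'_eq_blockProd (l n : ℕ) (x : ℝ) :
    ∏ i ∈ Finset.range l, (cfA' x (n + 1 + i) : ℝ) = blockProd l (gaussMap^[n] x) := by
  rw [blockProd, Nat.cast_prod]
  refine Finset.prod_congr rfl fun i _ => ?_
  rw [← cfA'_add, add_right_comm]

section Branch

variable (b : ℕ) {t : ℝ}

theorem gaussMap_branch (ht : t ∈ Ioo (0 : ℝ) 1) : gaussMap ((b : ℝ) + 1 + t)⁻¹ = t := by
  have h : (0 : ℝ) < (b : ℝ) + 1 + t := by have := ht.1; positivity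
  rw [gaussMap, if_neg (inv_ne_zero h.ne'), inv_inv]
  have : (b : ℝ) + 1 = ((b + 1 : ℕ) : ℝ) := by push_cast; ring
  rw [this, Int.fract_natCast_add, Int.fract_eq_self.2 ⟨ht.1.le, ht.2⟩]

theorem cfA'_branch (ht : t ∈ Ioo (0 : ℝ) 1) :
    cfA' ((b : ℝ) + 1 + t)⁻¹ 1 = if (b + 1).Prime then b + 1 else 0 := by
  have : cfA ((b : ℝ) + 1 + t)⁻¹ 1 = b + 1 := by
    simp only [cfA, Nat.sub_self, Function.iterate_zero, id, inv_inv]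
    rw [Nat.floor_eq_iff (by have := ht.1; positivity)]
    push_cast
    constructor <;> linarith [ht.1, ht.2]
  simp only [cfA', this]

end Branch

/-- The integral of `f` on `(0, 1)` against the density `1 / (q + r x) ^ 2`. -/
noncomputable def mobiusInt (q r : ℝ) (f : ℝ → ℝ≥0∞) : ℝ≥0∞ :=
  ∫⁻ x in Ioo (0 : ℝ) 1, ENNReal.ofReal (1 / (q + r * x) ^ 2) * f x

theorem mobiusInt_congr (q r : ℝ) {f g : ℝ → ℝ≥0∞} (h : ∀ x ∈ Ioo (0 : ℝ) 1, f x = g x) :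
    mobiusInt q r f = mobiusInt q r g :=
  setLIntegral_congr_fun measurableSet_Ioo fun x hx => by simp only [h x hx]

theorem iUnion_branch_ae_eq :
    (⋃ b : ℕ, (fun t : ℝ => ((b : ℝ) + 1 + t)⁻¹) '' Ioo 0 1) =ᵐ[volume] Ioo (0 : ℝ) 1 := by
  have hc : (range fun n : ℤ => (n : ℝ)⁻¹).Countable := countable_range _
  refine Filter.eventuallyEq_set.2 ?_
  filter_upwards [hc.ae_notMem volume] with x hx
  simp only [mem_iUnion, mem_image]
  constructor
  · rintro ⟨b, t, ht, rfl⟩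
    have := ht.1
    have h : (1 : ℝ) < (b : ℝ) + 1 + t := by
      have : (0 : ℝ) ≤ b := by positivity
      linarith
    exact ⟨by positivity, inv_lt_one_of_one_lt₀ h⟩
  · rintro ⟨h0, h1⟩
    have h2 : 1 < x⁻¹ := (one_lt_inv₀ h0).2 h1
    have h3 : 1 ≤ ⌊x⁻¹⌋₊ := (Nat.one_le_floor_iff _).2 h2.le
    refine ⟨⌊x⁻¹⌋₊ - 1, x⁻¹ - ⌊x⁻¹⌋₊, ⟨?_, ?_⟩, ?_⟩
    · refine sub_pos.2 (lt_of_le_of_ne (Nat.floor_le (by positivity)) fun h => hx ?_)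
      exact ⟨⌊x⁻¹⌋₊, by simp only [Int.cast_natCast, h, inv_inv]⟩
    · linarith [Nat.lt_floor_add_one x⁻¹]
    · push_cast [Nat.cast_sub h3]
      ring_nf
      exact inv_inv x

theorem mobiusInt_eq_tsum {q r : ℝ} (hq : 0 < q) (hr : 0 ≤ r) (f : ℝ → ℝ≥0∞) :
    mobiusInt q r f = ∑' b : ℕ, mobiusInt (((b + 1 : ℕ) : ℝ) * q + r) q
      fun t => f ((b : ℝ) + 1 + t)⁻¹ := by
  have hpos : ∀ (b : ℕ) (t : ℝ), t ∈ Ioo (0 : ℝ) 1 → (0 : ℝ) < (b : ℝ) + 1 + t := by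
    intro b t ht
    have := ht.1
    positivity
  have hderiv : ∀ (b : ℕ), ∀ t ∈ Ioo (0 : ℝ) 1, HasDerivWithinAt
      (fun t : ℝ => ((b : ℝ) + 1 + t)⁻¹) (-1 / ((b : ℝ) + 1 + t) ^ 2) (Ioo 0 1) t := by
    intro b t ht
    exact (((hasDerivAt_id t).const_add ((b : ℝ) + 1)).inv (hpos b t ht).ne').hasDerivWithinAt
  have hinj : ∀ b : ℕ, InjOn (fun t : ℝ => ((b : ℝ) + 1 + t)⁻¹) (Ioo 0 1) := by
    intro b s _ t _ h
    simpa using h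
  have hmeas : ∀ b : ℕ, MeasurableSet ((fun t : ℝ => ((b : ℝ) + 1 + t)⁻¹) '' Ioo 0 1) :=
    fun b => measurableSet_Ioo.image_of_continuousOn_injOn
      (fun t ht => (hderiv b t ht).continuousWithinAt) (hinj b)
  have hdisj : Pairwise (Function.onFun Disjoint
      fun b : ℕ => (fun t : ℝ => ((b : ℝ) + 1 + t)⁻¹) '' Ioo 0 1) := by
    intro b c hbc
    refine Set.disjoint_left.2 ?_
    rintro _ ⟨s, hs, rfl⟩ ⟨t, ht, h⟩
    have h1 : (c : ℝ) + 1 + t = b + 1 + s := inv_injective h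
    apply hbc
    have h2 : ⌊(c : ℝ) + t⌋₊ = c := by
      rw [Nat.floor_eq_iff (by have := ht.1; positivity)]
      constructor <;> linarith [ht.1, ht.2]
    have h3 : ⌊(b : ℝ) + s⌋₊ = b := by
      rw [Nat.floor_eq_iff (by have := hs.1; positivity)]
      constructor <;> linarith [hs.1, hs.2]
    rw [← h2, ← h3]
    congr 1
    linarith
  rw [mobiusInt, ← setLIntegral_congr iUnion_branch_ae_eq, lintegral_iUnion hmeas hdisj]
  refine tsum_congr fun b => ?_
  rw [lintegral_image_eq_lintegral_abs_deriv_mul measurableSet_Ioo (hderiv b) (hinj b)]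
  refine setLIntegral_congr_fun measurableSet_Ioo fun t ht => ?_
  have h := hpos b t ht
  have h' : 0 < q * ((b : ℝ) + 1 + t) + r := by positivity
  simp only
  rw [← mul_assoc, ← ENNReal.ofReal_mul (abs_nonneg _), abs_div, abs_neg, abs_one,
    abs_of_pos (pow_pos h 2)]
  congr 2
  have e : q + r * ((b : ℝ) + 1 + t)⁻¹ = (q * ((b : ℝ) + 1 + t) + r) / ((b : ℝ) + 1 + t) := by
    field_simp
  have e2 : ((b + 1 : ℕ) : ℝ) * q + r + q * t = q * ((b : ℝ) + 1 + t) + r := by push_cast; ring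
  rw [e, e2]
  field_simp

theorem mobiusInt_one_le {q r : ℝ} (hq : 0 < q) (hr : 0 ≤ r) :
    mobiusInt q r 1 ≤ ENNReal.ofReal (1 / q ^ 2) := by
  calc mobiusInt q r 1 ≤ ∫⁻ _ in Ioo (0 : ℝ) 1, ENNReal.ofReal (1 / q ^ 2) := by
        refine setLIntegral_mono' measurableSet_Ioo fun x hx => ?_
        rw [Pi.one_apply, mul_one]
        apply ENNReal.ofReal_le_ofReal
        gcongr
        nlinarith [hx.1]
    _ = _ := by simp

theorem le_mobiusInt_one {q r : ℝ} (hq : 0 < q) (hr : 0 ≤ r) (hrq : r ≤ q) :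
    ENNReal.ofReal (1 / (4 * q ^ 2)) ≤ mobiusInt q r 1 := by
  calc ENNReal.ofReal (1 / (4 * q ^ 2))
      = ∫⁻ _ in Ioo (0 : ℝ) 1, ENNReal.ofReal (1 / (4 * q ^ 2)) := by simp
    _ ≤ _ := by
        refine setLIntegral_mono' measurableSet_Ioo fun x hx => ?_
        rw [Pi.one_apply, mul_one]
        apply ENNReal.ofReal_le_ofReal
        have h0 := hx.1
        have h1 := hx.2
        have : q + r * x ≤ 2 * q := by nlinarith
        calc 1 / (4 * q ^ 2) = 1 / (2 * q) ^ 2 := by ring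
          _ ≤ _ := by gcongr

theorem mobiusInt_one_ne_top {q r : ℝ} (hq : 0 < q) (hr : 0 ≤ r) : mobiusInt q r 1 ≠ ∞ :=
  ne_top_of_le_ne_top ENNReal.ofReal_ne_top (mobiusInt_one_le hq hr)

theorem mobiusInt_branch_le {q r p : ℝ} (hq : 0 < q) (hr : 0 ≤ r) (hrq : r ≤ q) (hp : 1 ≤ p) :
    mobiusInt (p * q + r) q 1 ≤ 4 * ENNReal.ofReal (1 / p ^ 2) * mobiusInt q r 1 := by
  have hp0 : 0 < p := by linarith
  grw [← le_mobiusInt_one hq hr hrq, mobiusInt_one_le (by positivity) hq.le]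
  rw [← ENNReal.ofReal_ofNat, ← ENNReal.ofReal_mul (by positivity),
    ← ENNReal.ofReal_mul (by positivity)]
  apply ENNReal.ofReal_le_ofReal
  calc 1 / (p * q + r) ^ 2 ≤ 1 / (p * q) ^ 2 := by gcongr; linarith
    _ = _ := by field_simp

theorem le_mobiusInt_branch {q r p : ℝ} (hq : 0 < q) (hr : 0 ≤ r) (hrq : r ≤ q) (hp : 1 ≤ p) :
    ENNReal.ofReal (1 / 16) * ENNReal.ofReal (1 / p ^ 2) * mobiusInt q r 1 ≤
      mobiusInt (p * q + r) q 1 := by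
  have hp0 : 0 < p := by linarith
  grw [mobiusInt_one_le hq hr, ← le_mobiusInt_one (by positivity) hq.le (by nlinarith)]
  rw [← ENNReal.ofReal_mul (by positivity), ← ENNReal.ofReal_mul (by positivity)]
  apply ENNReal.ofReal_le_ofReal
  calc 1 / 16 * (1 / p ^ 2) * (1 / q ^ 2) = 1 / (4 * (p * q + p * q) ^ 2) := by field_simp; norm_num
    _ ≤ _ := by gcongr; nlinarith

open Classical in
/-- The indicator function of `y ≤ a'_1(x) ⋯ a'_l(x)`. -/
noncomputable def tailInd (l : ℕ) (y : ℝ) (x : ℝ) : ℝ≥0∞ :=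
  if y ≤ blockProd l x then 1 else 0

theorem mobiusInt_tailInd_succ {q r : ℝ} (hq : 0 < q) (hr : 0 ≤ r) (l : ℕ) {y : ℝ} (hy : 0 < y) :
    mobiusInt q r (tailInd (l + 1) y) =
      ∑' p : ℕ, if p.Prime then mobiusInt (p * q + r) q (tailInd l (y / p)) else 0 := by
  rw [tsum_eq_zero_add' ENNReal.summable, if_neg Nat.not_prime_zero, zero_add,
    mobiusInt_eq_tsum hq hr]
  refine tsum_congr fun b => ?_
  have hval : ∀ t ∈ Ioo (0 : ℝ) 1, blockProd (l + 1) ((b : ℝ) + 1 + t)⁻¹ =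
      (if (b + 1).Prime then b + 1 else 0) * blockProd l t := fun t ht => by
    rw [blockProd_succ, gaussMap_branch b ht, cfA'_branch b ht]
  split_ifs with hb
  · refine mobiusInt_congr _ _ fun t ht => ?_
    rw [tailInd, hval t ht, if_pos hb, tailInd]
    have hb0 : (0 : ℝ) < ((b + 1 : ℕ) : ℝ) := by positivity
    simp only [div_le_iff₀' hb0, Nat.cast_mul]
  · rw [mobiusInt_congr (g := fun _ => 0), mobiusInt]
    · simp
    · intro t ht
      rw [tailInd, hval t ht, if_neg hb, zero_mul, Nat.cast_zero, if_neg hy.not_ge]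

theorem mobiusInt_tailInd_zero (q r y : ℝ) :
    mobiusInt q r (tailInd 0 y) = primeTail 0 y * mobiusInt q r 1 := by
  have : tailInd 0 y = if y ≤ 1 then 1 else 0 := by
    funext x
    simp only [tailInd, blockProd, Finset.range_zero, Finset.prod_empty, Nat.cast_one]
    split_ifs <;> rfl
  rw [this, primeTail]
  split_ifs
  · rw [one_mul]
  · simp [mobiusInt]

theorem mobiusInt_tailInd_le (l : ℕ) {q r y : ℝ} (hq : 0 < q) (hr : 0 ≤ r) (hrq : r ≤ q)
    (hy : 0 < y) :
    mobiusInt q r (tailInd l y) ≤ 4 ^ l * primeTail l y * mobiusInt q r 1 := by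
  induction l generalizing q r y with
  | zero => rw [mobiusInt_tailInd_zero, pow_zero, one_mul]
  | succ l ih =>
    rw [mobiusInt_tailInd_succ hq hr l hy, primeTail, ← ENNReal.tsum_mul_left,
      ← ENNReal.tsum_mul_right]
    refine ENNReal.tsum_le_tsum fun p => ?_
    split_ifs with hp
    · have hp1 : (1 : ℝ) ≤ p := by exact_mod_cast hp.one_lt.le
      have hp0 : (0 : ℝ) < p := by linarith
      refine (ih (by positivity) hq.le (by nlinarith) (by positivity)).trans ?_
      grw [mobiusInt_branch_le hq hr hrq hp1]
      apply le_of_eq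
      ring
    · simp

theorem le_mobiusInt_tailInd (l : ℕ) {q r y : ℝ} (hq : 0 < q) (hr : 0 ≤ r) (hrq : r ≤ q)
    (hy : 0 < y) :
    ENNReal.ofReal (1 / 16) ^ l * primeTail l y * mobiusInt q r 1 ≤
      mobiusInt q r (tailInd l y) := by
  induction l generalizing q r y with
  | zero => rw [mobiusInt_tailInd_zero, pow_zero, one_mul]
  | succ l ih =>
    rw [mobiusInt_tailInd_succ hq hr l hy, primeTail, ← ENNReal.tsum_mul_left,
      ← ENNReal.tsum_mul_right]
    refine ENNReal.tsum_le_tsum fun p => ?_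
    split_ifs with hp
    · have hp1 : (1 : ℝ) ≤ p := by exact_mod_cast hp.one_lt.le
      have hp0 : (0 : ℝ) < p := by linarith
      refine le_trans ?_ (ih (by positivity) hq.le (by nlinarith) (by positivity))
      grw [← le_mobiusInt_branch hq hr hrq hp1]
      apply le_of_eq
      ring
    · simp

/-- `f` has mean at most `δ` with respect to every density `1 / (q + r x) ^ 2`, `0 ≤ r ≤ q`. -/
def MeanLE (f : ℝ → ℝ≥0∞) (δ : ℝ≥0∞) : Prop :=
  ∀ q r : ℝ, 0 < q → 0 ≤ r → r ≤ q → mobiusInt q r f ≤ δ * mobiusInt q r 1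

theorem MeanLE.mobiusInt_mul_comp_iterate_le {f : ℝ → ℝ≥0∞} {δ : ℝ≥0∞} (h : MeanLE f δ) (l : ℕ)
    (w : ℕ → ℝ≥0∞) (hw : ∀ n, w n ≠ ∞) {q r : ℝ} (hq : 0 < q) (hr : 0 ≤ r) (hrq : r ≤ q) :
    mobiusInt q r (fun x => w (blockProd l x) * f (gaussMap^[l] x)) ≤
      δ * mobiusInt q r (fun x => w (blockProd l x)) := by
  induction l generalizing w q r with
  | zero =>
    have key : ∀ g : ℝ → ℝ≥0∞, mobiusInt q r (fun x => w 1 * g x) = w 1 * mobiusInt q r g := by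
      intro g
      simp only [mobiusInt]
      rw [← lintegral_const_mul' _ _ (hw 1)]
      simp only [mul_left_comm]
    have h1 := key f
    have h2 := key 1
    simp only [Pi.one_apply, mul_one] at h2
    simp only [blockProd, Finset.range_zero, Finset.prod_empty, Function.iterate_zero, id]
    rw [h1, h2, mul_left_comm]
    gcongr
    exact h q r hq hr hrq
  | succ l ih =>
    rw [mobiusInt_eq_tsum hq hr, mobiusInt_eq_tsum hq hr, ← ENNReal.tsum_mul_left]
    refine ENNReal.tsum_le_tsum fun b => ?_
    have hb : (1 : ℝ) ≤ ((b + 1 : ℕ) : ℝ) := by simp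
    have key := ih (fun n => w ((if (b + 1).Prime then b + 1 else 0) * n)) (fun n => hw _)
      (q := ((b + 1 : ℕ) : ℝ) * q + r) (r := q) (by positivity) hq.le (by nlinarith)
    convert! key using 1
    · refine mobiusInt_congr _ _ fun t ht => ?_
      rw [blockProd_succ, Function.iterate_succ_apply, gaussMap_branch b ht, cfA'_branch b ht]
    · congr 1
      refine mobiusInt_congr _ _ fun t ht => ?_
      rw [blockProd_succ, gaussMap_branch b ht, cfA'_branch b ht]

theorem MeanLE.comp_iterate {f : ℝ → ℝ≥0∞} {δ : ℝ≥0∞} (h : MeanLE f δ) (l : ℕ) :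
    MeanLE (fun x => f (gaussMap^[l] x)) δ := by
  intro q r hq hr hrq
  have := h.mobiusInt_mul_comp_iterate_le l (fun _ => 1) (fun _ => ENNReal.one_ne_top) hq hr hrq
  simp only [one_mul] at this
  exact this

theorem meanLE_tailInd (l : ℕ) {y : ℝ} (hy : 0 < y) :
    MeanLE (tailInd l y) (4 ^ l * primeTail l y) :=
  fun _ _ hq hr hrq => mobiusInt_tailInd_le l hq hr hrq hy

open Classical in
theorem mobiusInt_compl_tailInd_le (l : ℕ) {q r y : ℝ} (hq : 0 < q) (hr : 0 ≤ r) (hrq : r ≤ q)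
    (hy : 0 < y) :
    mobiusInt q r (fun x => if y ≤ blockProd l x then 0 else 1) ≤
      (1 - ENNReal.ofReal (1 / 16) ^ l * primeTail l y) * mobiusInt q r 1 := by
  have hset : MeasurableSet {x | y ≤ blockProd l x} :=
    measurableSet_le measurable_const (measurable_from_top.comp (measurable_blockProd l))
  have hm : Measurable (tailInd l y) := Measurable.ite hset measurable_const measurable_const
  have hsum : mobiusInt q r (tailInd l y) +
      mobiusInt q r (fun x => if y ≤ blockProd l x then 0 else 1) = mobiusInt q r 1 := by
    rw [mobiusInt, mobiusInt, ← lintegral_add_left (by fun_prop), mobiusInt]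
    congr 1 with x
    rw [← mul_add, tailInd]
    split_ifs <;> simp
  have hle := le_mobiusInt_tailInd l hq hr hrq hy
  have hfin := mobiusInt_one_ne_top hq hr
  rw [ENNReal.sub_mul fun _ _ => hfin, one_mul]
  have hfin' : ENNReal.ofReal (1 / 16) ^ l * primeTail l y * mobiusInt q r 1 ≠ ∞ :=
    ne_top_of_le_ne_top hfin (hle.trans (hsum ▸ le_self_add))
  refine ENNReal.le_sub_of_add_le_left hfin' ?_
  exact (add_le_add hle le_rfl).trans hsum.le

open Classical in
/-- The indicator function of the `x` none of whose first `N` consecutive blocks of `l` partial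
quotients satisfies `ψ k ≤ a'_{kl+1}(x) ⋯ a'_{kl+l}(x)`. -/
noncomputable def avoidInd (l : ℕ) (ψ : ℕ → ℝ) (N : ℕ) (x : ℝ) : ℝ≥0∞ :=
  if ∀ k < N, ¬ ψ k ≤ blockProd l (gaussMap^[l * k] x) then 1 else 0

theorem meanLE_avoidInd (l N : ℕ) (ψ : ℕ → ℝ) (hψ : ∀ k, 0 < ψ k) :
    MeanLE (avoidInd l ψ N)
      (∏ k ∈ Finset.range N, (1 - ENNReal.ofReal (1 / 16) ^ l * primeTail l (ψ k))) := by
  classical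
  induction N generalizing ψ with
  | zero =>
    intro q r _ _ _
    have : avoidInd l ψ 0 = 1 := by funext x; simp [avoidInd]
    simp [this]
  | succ N ih =>
    intro q r hq hr hrq
    have hrec : avoidInd l ψ (N + 1) = fun x => (fun n : ℕ => if ψ 0 ≤ n then (0 : ℝ≥0∞) else 1)
        (blockProd l x) * avoidInd l (fun k => ψ (k + 1)) N (gaussMap^[l] x) := by
      funext x
      simp only [avoidInd, Nat.forall_lt_succ_left, mul_zero, Function.iterate_zero, id, mul_add,
        mul_one, Function.iterate_add_apply]
      split_ifs <;> simp_all
    rw [hrec, Finset.prod_range_succ', mul_assoc]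
    refine ((ih _ fun k => hψ (k + 1)).mobiusInt_mul_comp_iterate_le l
      (fun n : ℕ => if ψ 0 ≤ n then (0 : ℝ≥0∞) else 1) ?_ hq hr hrq).trans ?_
    · intro n
      split_ifs <;> simp
    · gcongr
      exact mobiusInt_compl_tailInd_le l hq hr hrq (hψ 0)

theorem mobiusInt_one_zero (f : ℝ → ℝ≥0∞) : mobiusInt 1 0 f = ∫⁻ x in Ioo (0 : ℝ) 1, f x := by
  simp [mobiusInt]

theorem MeanLE.volume_le {s : Set ℝ} (hs : MeasurableSet s) {δ : ℝ≥0∞}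
    (h : MeanLE (s.indicator 1) δ) : volume (s ∩ Ioo 0 1) ≤ δ := by
  have := h 1 0 one_pos le_rfl zero_le_one
  rw [mobiusInt_one_zero, mobiusInt_one_zero, lintegral_indicator_one hs,
    Measure.restrict_apply hs] at this
  simpa using this

theorem measurableSet_le_blockProd (l n : ℕ) (y : ℝ) :
    MeasurableSet {x | y ≤ blockProd l (gaussMap^[n] x)} :=
  measurableSet_le measurable_const (measurable_from_top.comp
    ((measurable_blockProd l).comp (measurable_gaussMap.iterate n)))

theorem volume_le_blockProd_le (l n : ℕ) {y : ℝ} (hy : 0 < y) :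
    volume ({x | y ≤ blockProd l (gaussMap^[n] x)} ∩ Ioo 0 1) ≤ 4 ^ l * primeTail l y := by
  refine MeanLE.volume_le (measurableSet_le_blockProd l n y) ?_
  convert! (meanLE_tailInd l hy).comp_iterate n using 1

theorem volume_avoid_le (l n N : ℕ) {ψ : ℕ → ℝ} (hψ : ∀ k, 0 < ψ k) :
    volume ({x | ∀ k < N, ¬ ψ k ≤ blockProd l (gaussMap^[l * k + n] x)} ∩ Ioo 0 1) ≤
      ∏ k ∈ Finset.range N, (1 - ENNReal.ofReal (1 / 16) ^ l * primeTail l (ψ k)) := by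
  refine MeanLE.volume_le ?_ ?_
  · simp only [ofPred_forall]
    exact MeasurableSet.iInter fun k => MeasurableSet.iInter fun _ =>
      (measurableSet_le_blockProd l (l * k + n) (ψ k)).compl
  · convert! (meanLE_avoidInd l N ψ hψ).comp_iterate n using 1
    funext x
    simp [avoidInd, indicator_apply, Function.iterate_add_apply]

/-- The general term of the series that governs the measure of `Eprimeℓ (l + 1) φ`. -/
noncomputable def tailTerm (l : ℕ) (y : ℝ) : ℝ :=
  Real.log (Real.log y) ^ l / (y * Real.log y)

theorem tailTerm_nonneg (l : ℕ) {y : ℝ} (hy : 3 ≤ y) : 0 ≤ tailTerm l y := by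
  have h : 1 < Real.log y := log_three_gt_one.trans_le (Real.log_le_log (by norm_num) hy)
  have := Real.log_pos h
  unfold tailTerm
  positivity

theorem volume_Eprimeℓ_eq_zero (l : ℕ) {φ : ℕ → ℝ} (hφ : ∀ n, 3 ≤ φ n)
    (hs : Summable fun n => tailTerm l (φ n)) : volume (Eprimeℓ (l + 1) φ) = 0 := by
  obtain ⟨C, hC, hle⟩ := exists_primeTail_le_of_three_le l
  have hb : ∀ n, volume ({x | φ n ≤ blockProd (l + 1) (gaussMap^[n - 1] x)} ∩ Ioo 0 1) ≤
      4 ^ (l + 1) * ENNReal.ofReal (C * tailTerm l (φ n)) := fun n =>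
    (volume_le_blockProd_le (l + 1) (n - 1) (by linarith [hφ n])).trans
      (mul_le_mul_right (hle _ (hφ n)) _)
  have hfin : ∑' n, volume ({x | φ n ≤ blockProd (l + 1) (gaussMap^[n - 1] x)} ∩ Ioo 0 1) ≠ ∞ := by
    refine ne_top_of_le_ne_top ?_ (ENNReal.tsum_le_tsum hb)
    rw [ENNReal.tsum_mul_left]
    exact ENNReal.mul_ne_top (by finiteness) (hs.mul_left C).tsum_ofReal_ne_top
  refine measure_mono_null ?_ (measure_setOfPred_frequently_eq_zero hfin)
  rintro x ⟨hx, hirr, hinf⟩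
  refine (Nat.frequently_atTop_iff_infinite.2 hinf).mono ?_
  rintro n ⟨hn, hle⟩
  refine ⟨?_, lt_of_le_of_ne hx.1 (hirr.ne_zero).symm, hx.2⟩
  obtain ⟨m, rfl⟩ := Nat.exists_eq_add_of_le' hn
  rwa [prod_cfA'_eq_blockProd] at hle

theorem exists_not_summable_comp_mul_add {f : ℕ → ℝ} (m : ℕ) [NeZero m] (hf : ¬ Summable f) :
    ∃ r, ¬ Summable fun k => f (m * k + r) := by
  contrapose! hf
  have hsum := summable_sum (s := Finset.univ) fun (a : ZMod m) _ =>
    (summable_indicator_mod_iff_summable m a.val f).2 (hf a.val)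
  simp only [ZMod.natCast_zmod_val] at hsum
  rw [Finset.sum_indicator_mod m f]
  convert! hsum
  simp only [Finset.sum_apply]

theorem volume_avoid_eq_zero (l n : ℕ) {ψ : ℕ → ℝ} (hψ : ∀ k, 3 ≤ ψ k)
    (hs : ¬ Summable fun k => tailTerm l (ψ k)) :
    volume ({x | ∀ k, ¬ ψ k ≤ blockProd (l + 1) (gaussMap^[(l + 1) * k + n] x)} ∩ Ioo 0 1) = 0 := by
  obtain ⟨c, hc, hle⟩ := exists_le_primeTail_of_three_le l
  set c' : ℝ := (1 / 16) ^ (l + 1) * c with hc'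
  have hc'0 : 0 < c' := by positivity
  have hbound : ∀ N, volume
      ({x | ∀ k, ¬ ψ k ≤ blockProd (l + 1) (gaussMap^[(l + 1) * k + n] x)} ∩ Ioo 0 1) ≤
      ENNReal.ofReal (Real.exp (-∑ k ∈ Finset.range N, c' * tailTerm l (ψ k))) := by
    intro N
    calc _ ≤ volume ({x | ∀ k < N, ¬ ψ k ≤
          blockProd (l + 1) (gaussMap^[(l + 1) * k + n] x)} ∩ Ioo 0 1) :=
        measure_mono (inter_subset_inter_left _ fun x (hx : ∀ k, _) k _ => hx k)
      _ ≤ _ := volume_avoid_le (l + 1) n N fun k => zero_lt_three.trans_le (hψ k)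
      _ ≤ ∏ k ∈ Finset.range N, ENNReal.ofReal (Real.exp (-(c' * tailTerm l (ψ k)))) := by
        refine Finset.prod_le_prod' fun k _ => ?_
        grw [← hle _ (hψ k)]
        rw [← ENNReal.ofReal_pow (by norm_num), ← ENNReal.ofReal_mul (by positivity),
          ← ENNReal.ofReal_one, ← ENNReal.ofReal_sub]
        · apply ENNReal.ofReal_le_ofReal
          rw [← mul_assoc, ← hc']
          exact Real.one_sub_le_exp_neg _
        · have := tailTerm_nonneg l (hψ k)
          rw [tailTerm] at this
          positivity
      _ = _ := by
        rw [← ENNReal.ofReal_prod_of_nonneg fun _ _ => (Real.exp_pos _).le, ← Real.exp_sum,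
          Finset.sum_neg_distrib]
  have hdiv : Tendsto (fun N => ∑ k ∈ Finset.range N, c' * tailTerm l (ψ k)) atTop atTop := by
    refine (not_summable_iff_tendsto_nat_atTop_of_nonneg fun k => ?_).1 ?_
    · exact mul_nonneg hc'0.le (tailTerm_nonneg l (hψ k))
    · rwa [summable_mul_left_iff hc'0.ne']
  have hlim := ENNReal.tendsto_ofReal (Real.tendsto_exp_neg_atTop_nhds_zero.comp hdiv)
  rw [ENNReal.ofReal_zero] at hlim
  exact le_antisymm (ge_of_tendsto' hlim hbound) zero_le

theorem volume_Eprimeℓ_eq_one (l : ℕ) {φ : ℕ → ℝ} (hφ : ∀ n, 3 ≤ φ n)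
    (hs : ¬ Summable fun n => tailTerm l (φ n)) : volume (Eprimeℓ (l + 1) φ) = 1 := by
  obtain ⟨r, hr⟩ := exists_not_summable_comp_mul_add (l + 1) hs
  set Z : ℕ → Set ℝ := fun K => {x | ∀ k, ¬ φ ((l + 1) * (k + (K + 1)) + r) ≤
    blockProd (l + 1) (gaussMap^[(l + 1) * k + ((l + 1) * (K + 1) + r - 1)] x)} ∩ Ioo 0 1 with hZ
  have hZ0 : ∀ K, volume (Z K) = 0 := fun K => by
    refine volume_avoid_eq_zero l _ (fun k => hφ _) ?_
    rwa [summable_nat_add_iff (f := fun k => tailTerm l (φ ((l + 1) * k + r))) (K + 1)]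
  have hnull : volume (range ((↑) : ℚ → ℝ) ∪ ⋃ K, Z K) = 0 :=
    measure_union_null ((countable_range _).measure_zero volume) (measure_iUnion_null hZ0)
  have hsub : Ioo (0 : ℝ) 1 ⊆ Eprimeℓ (l + 1) φ ∪ (range ((↑) : ℚ → ℝ) ∪ ⋃ K, Z K) := by
    intro x hx
    by_cases hirr : Irrational x
    swap
    · exact Or.inr (Or.inl (not_not.1 hirr))
    by_cases hK : ∃ K, x ∈ Z K
    · exact Or.inr (Or.inr (mem_iUnion.2 hK))
    refine Or.inl ⟨Ioo_subset_Ico_self hx, hirr, Set.infinite_of_not_bddAbove ?_⟩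
    rintro ⟨K, hbdd⟩
    refine hK ⟨K, fun k hk => ?_, hx⟩
    have hge : K + 1 ≤ (l + 1) * (k + (K + 1)) + r := by nlinarith
    have hmem := hbdd (a := (l + 1) * (k + (K + 1)) + r) ⟨by omega, ?_⟩
    · omega
    · convert! hk
      rw [← prod_cfA'_eq_blockProd]
      have : (l + 1) * (k + (K + 1)) + r =
          (l + 1) * k + ((l + 1) * (K + 1) + r - 1) + 1 := by
        have : 1 ≤ (l + 1) * (K + 1) := Nat.mul_pos l.succ_pos K.succ_pos
        rw [mul_add]
        omega
      rw [this]
  refine le_antisymm ?_ ?_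
  · calc _ ≤ volume (Ico (0 : ℝ) 1) := measure_mono fun x hx => hx.1
      _ = 1 := by simp
  · calc 1 = volume (Ioo (0 : ℝ) 1) := by simp
      _ ≤ _ := measure_mono hsub
      _ ≤ _ := measure_union_le _ _
      _ = _ := by rw [hnull, add_zero]

/-- **Theorem.** Let `ℓ ≥ 1` and `φ : ℕ → [3, ∞)`. If
`∑_n (log log φ(n))^{ℓ-1} / (φ(n) log φ(n))` converges then `leb(E′_ℓ(φ)) = 0`, and if it
diverges then `leb(E′_ℓ(φ)) = 1`. -/
theorem lebesgue_measure_Eprimeℓ (ℓ : ℕ) (hℓ : 1 ≤ ℓ) (φ : ℕ → ℝ) (hφ : ∀ n, 3 ≤ φ n) :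
    (Summable (fun n : ℕ =>
        Real.log (Real.log (φ n)) ^ (ℓ - 1) / (φ n * Real.log (φ n))) →
      volume (Eprimeℓ ℓ φ) = 0) ∧
    (¬ Summable (fun n : ℕ =>
        Real.log (Real.log (φ n)) ^ (ℓ - 1) / (φ n * Real.log (φ n))) →
      volume (Eprimeℓ ℓ φ) = 1) := by
  obtain ⟨l, rfl⟩ := Nat.exists_eq_add_of_le' hℓ
  exact ⟨volume_Eprimeℓ_eq_zero l hφ, volume_Eprimeℓ_eq_one l hφ⟩
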